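/- Each transaction $t$ has a size $s_t>0$, a private valuation $v_t\ge 0$ per unit size and a bid $b_t\ge 0$ per unit size. Fix a capacity $K>0$ and a marginal cost $\mu\ge 0$ of the miner per unit size; a set $B$ of transactions is feasible if $\sum_{t\in B}s_t\le K$. Let $\beta\in(0,1]$. In the $\beta$-burn first-price auction, an included transaction pays $(1-\beta)b_t$ per unit size to the miner and burns $\beta b_t$ per unit size. Its allocation rule is a fixed function of the on-chain history, the pending transactions, their sizes and their bids (so ties are broken in an arbitrary but fixed way), which chooses a feasible set $B$ of pending transactions, either always maximizing $\sum_{t\in B}(b_t-\mu)s_t$ (the first-price rule) or always maximizing $\sum_{t\in B}((1-\beta)b_t-\mu)s_t$ (the miner's net revenue); for $\mu=0$ and $\beta<1$ these are the same. The joint utility of a block $B$ under bids $b$ is $\sum_{t\in B}(v_t-\beta b_t-\mu)s_t$. An off-chain agreement (OCA) between the miner and the creators of the transactions in a finite set $T$ specifies bids $b_t\ge0$, a feasible block $B\subseteq T$ to be mined, and transfers $\tau_t s_t$ ($\tau_t\in\mathbb R$) from the creators to the miner. The creator of $t$ then has utility $(v_t-b_t)s_t-\tau_t s_t$ if $t\in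 B$ and $-\tau_t s_t$ otherwise, and the miner has utility $\sum_{t\in B}((1-\beta)b_t-\mu)s_t+\sum_{t\in T}\tau_t s_t$. A bidding strategy is a function $\sigma:\mathbb R_{\ge0}\to\mathbb R_{\ge0}$ from valuations to bids; it is individually rational if, for every history, every finite $T$ and all sizes and valuations, no transaction included on bids $\sigma(v)$ pays (to the miner and in burn together) more than its valuation. The mechanism is OCA-proof if for every history there is an individually rational $\sigma$ such that for all finite $T$, sizes $s$ and valuations $v$, no OCA makes every creator and the miner strictly better off than in the block that the allocation rule produces on bids $\sigma(v)$, without transfers. Then: 1. The $\beta$-burn first-price auction is not OCA-proof. 2. For every history and every bidding strategy $\sigma$ (individually rational or not), there are a finite set $T$ of transactions with sizes $s_t>0$ and valuations $v_t\ge0$, a bid vector $b$, and a feasible block $B\subseteq T$ whose joint utility under bids $b$ is strictly greater than the joint utility, under bids $\sigma(v)$, of the block that the allocation rule produces on bids $\sigma(v)$. 3. If the allocation rule is the first-price rule, or if $\beta<1$, then in (2) the block can moreover be taken to be the one that the allocation rule itself produces on bids $b$. Hence no bidding strategy guarantees joint-utility maximization among on-chain outcomes. -/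

import Mathlib

open scoped NNReal

/-- A transaction as recorded on-chain: identifier, size, bid per unit size. -/
structure ConfirmedTx where
  id : ℕ
  size : ℝ
  bid : ℝ≥0

/-- The on-chain history: the sequence of earlier blocks, each a sequence of transactions. -/
abbrev History := List (List ConfirmedTx)

/-- A feasible allocation rule for capacity `K`. Transactions are identified by natural numbers.
From the history and the mempool (the finite set `T` of pending transactions, with their sizes and
bids) it determines the set of included transactions. Valuations are not an input, and neither are
sizes or bids of transactions outside `T`; ties may be broken in any way, by a fixed function
of this input. -/
structure AllocationRule (K : ℝ) where
  block : History → (T : Finset ℕ) → (T → ℝ) → (T → ℝ≥0) → Finset ℕ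
  block_subset : ∀ H T s b, block H T s b ⊆ T
  block_feasible : ∀ H (T : Finset ℕ) (s : ℕ → ℝ) (b : T → ℝ≥0), (∀ t ∈ T, 0 < s t) →
    ∑ t ∈ block H T (T.restrict s) b, s t ≤ K

/-- A transaction fee mechanism: a feasible allocation rule, a payment rule and a burning rule.
Payments and burns (per unit size) depend only on the history and on the transactions included in
the block, with their sizes and bids. -/
structure TFM (K : ℝ) where
  alloc : AllocationRule K
  pay : History → (B : Finset ℕ) → (B → ℝ) → (B → ℝ≥0) → B → ℝ
  burn : History → (B : Finset ℕ) → (B → ℝ) → (B → ℝ≥0) → B → ℝ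
  pay_nonneg : ∀ H B s b t, 0 ≤ pay H B s b t
  burn_nonneg : ∀ H B s b t, 0 ≤ burn H B s b t

namespace TFM

variable {K : ℝ}

/-- The block `x(H, T(b))` produced by the allocation rule on the transactions `T` with sizes `s`
and bids `b`. -/
def outcome (M : TFM K) (H : History) (T : Finset ℕ) (s : ℕ → ℝ) (b : ℕ → ℝ≥0) : Finset ℕ :=
  M.alloc.block H T (T.restrict s) (T.restrict b)

/-- Utility of the creator of transaction `t`, with valuations `v`, bids `b`, mined block `B` and
off-chain transfers `τ t` per unit size from the creators to the miner (the transfer is made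
whether or not `t` is included). Without off-chain transfers, `τ = 0`. -/
noncomputable def userUtility (M : TFM K) (H : History) (s : ℕ → ℝ) (v b : ℕ → ℝ≥0)
    (B : Finset ℕ) (τ : ℕ → ℝ) (t : ℕ) : ℝ :=
  (if h : t ∈ B then
    ((v t : ℝ) - M.pay H B (B.restrict s) (B.restrict b) ⟨t, h⟩
      - M.burn H B (B.restrict s) (B.restrict b) ⟨t, h⟩) * s t
  else 0) - τ t * s t

/-- Utility of a myopic miner with marginal cost `μ` who mines the block `B` of real transactions,
including the off-chain transfers from the creators of the transactions in `T`. -/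
noncomputable def minerUtility (M : TFM K) (μ : ℝ) (H : History) (T : Finset ℕ) (s : ℕ → ℝ)
    (b : ℕ → ℝ≥0) (B : Finset ℕ) (τ : ℕ → ℝ) : ℝ :=
  ∑ t : B, M.pay H B (B.restrict s) (B.restrict b) t * s t - μ * ∑ t ∈ B, s t
    + ∑ t ∈ T, τ t * s t

/-- Joint utility of the miner and the creators for the block `B` under bids `b`. -/
noncomputable def jointUtility (M : TFM K) (μ : ℝ) (H : History) (s : ℕ → ℝ) (v b : ℕ → ℝ≥0)
    (B : Finset ℕ) : ℝ :=
  ∑ t : B, ((v t : ℝ) - M.burn H B (B.restrict s) (B.restrict b) t - μ) * s t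

/-- Individual rationality: collective bidding according to `σ` never makes an included
transaction pay more (to the miner and in burn) than its valuation. -/
def IndividuallyRational (M : TFM K) (σ : ℝ≥0 → ℝ≥0) : Prop :=
  ∀ (H : History) (T : Finset ℕ) (s : ℕ → ℝ) (v : ℕ → ℝ≥0), (∀ t ∈ T, 0 < s t) →
    ∀ (B : Finset ℕ), B = M.outcome H T s (σ ∘ v) → ∀ t : B,
      M.pay H B (B.restrict s) (B.restrict (σ ∘ v)) t
        + M.burn H B (B.restrict s) (B.restrict (σ ∘ v)) t ≤ v t

end TFM

/-- An off-chain agreement between the creators of the transactions in `T` and a miner: a bid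
vector, a feasible block of transactions of `T` to be mined (not necessarily the one of the
allocation rule), and per-size transfers to the miner (a refund if negative). -/
structure OCA (K : ℝ) (T : Finset ℕ) (s : ℕ → ℝ) where
  bid : ℕ → ℝ≥0
  block : Finset ℕ
  transfer : ℕ → ℝ
  block_subset : block ⊆ T
  block_feasible : ∑ t ∈ block, s t ≤ K

namespace TFM

variable {K : ℝ}

/-- The agreement `A` makes every creator of a transaction in `T` and the miner strictly better
off than in the on-chain outcome with bids `b` and no off-chain transfers. -/
def ImprovedBy (M : TFM K) (μ : ℝ) (H : History) (T : Finset ℕ) (s : ℕ → ℝ) (v b : ℕ → ℝ≥0)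
    (A : OCA K T s) : Prop :=
  (∀ t ∈ T, M.userUtility H s v b (M.outcome H T s b) 0 t
      < M.userUtility H s v A.bid A.block A.transfer t) ∧
    M.minerUtility μ H T s b (M.outcome H T s b) 0
      < M.minerUtility μ H T s A.bid A.block A.transfer

/-- OCA-proofness: for every history there is an individually rational bidding strategy whose
on-chain outcome is never improved upon by an off-chain agreement. -/
def OCAProof (M : TFM K) (μ : ℝ) : Prop :=
  ∀ H : History, ∃ σ : ℝ≥0 → ℝ≥0, M.IndividuallyRational σ ∧
    ∀ (T : Finset ℕ) (s : ℕ → ℝ) (v : ℕ → ℝ≥0), (∀ t ∈ T, 0 < s t) →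
      ¬ ∃ A : OCA K T s, M.ImprovedBy μ H T s v (σ ∘ v) A

end TFM

namespace AllocationRule

variable {K : ℝ}

/-- The allocation rule always chooses a feasible block that maximizes
`∑ (c * b t - μ) * s t`. -/
def Maximizes (x : AllocationRule K) (c μ : ℝ) : Prop :=
  ∀ (H : History) (T : Finset ℕ) (s : ℕ → ℝ) (b : ℕ → ℝ≥0), (∀ t ∈ T, 0 < s t) →
    ∀ B ⊆ T, ∑ t ∈ B, s t ≤ K →
      ∑ t ∈ B, (c * b t - μ) * s t
        ≤ ∑ t ∈ x.block H T (T.restrict s) (T.restrict b), (c * b t - μ) * s t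

/-- The allocation rule of first-price auctions: maximize the size-weighted sum of the bids
(less marginal costs). -/
def IsFirstPrice (x : AllocationRule K) (μ : ℝ) : Prop :=
  x.Maximizes 1 μ

/-- The rule maximizes the miner's revenue (less marginal costs) when the miner receives
`(1 - β) * b t` per unit size. For `μ = 0` and `β < 1` this is the same as `IsFirstPrice`. -/
def IsRevenueMaximizing (x : AllocationRule K) (β μ : ℝ) : Prop :=
  x.Maximizes (1 - β) μ

end AllocationRule

/-- The `β`-burn first-price auction with allocation rule `x`: an included transaction pays
`(1 - β) * b t` per unit size to the miner and burns `β * b t` per unit size. -/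
def burnFPA {K : ℝ} (β : ℝ) (hβ0 : 0 ≤ β) (hβ1 : β ≤ 1) (x : AllocationRule K) : TFM K where
  alloc := x
  pay _ _ _ b t := (1 - β) * b t
  burn _ _ _ b t := β * b t
  pay_nonneg _ _ _ b t := mul_nonneg (sub_nonneg.2 hβ1) (b t).2
  burn_nonneg _ _ _ b t := mul_nonneg hβ0 (b t).2

namespace TFM

variable {K : ℝ}

/-- Off-chain transfers and payments to the miner cancel in the sum of all utilities. -/
theorem sum_userUtility_add_minerUtility (M : TFM K) (μ : ℝ) (H : History) {T : Finset ℕ}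
    (s : ℕ → ℝ) (v b : ℕ → ℝ≥0) {B : Finset ℕ} (hB : B ⊆ T) (τ : ℕ → ℝ) :
    ∑ t ∈ T, M.userUtility H s v b B τ t + M.minerUtility μ H T s b B τ
      = M.jointUtility μ H s v b B := by
  have key : ∀ f : B → ℝ, ∑ t ∈ T, (if h : t ∈ B then f ⟨t, h⟩ else 0) = ∑ t : B, f t := by
    intro f
    rw [← Finset.sum_subset hB (fun t _ ht => dif_neg ht), ← Finset.sum_coe_sort]
    exact Finset.sum_congr rfl fun t _ => dif_pos t.2
  unfold userUtility minerUtility jointUtility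
  rw [Finset.sum_sub_distrib, key fun t => ((v t : ℝ) - M.pay H B (B.restrict s) (B.restrict b) t
      - M.burn H B (B.restrict s) (B.restrict b) t) * s t, ← Finset.sum_coe_sort B s,
    Finset.mul_sum]
  have : ∀ a p c d : ℝ, a - c + (p - d + c) = a + p - d := fun a p c d => by ring
  rw [this, ← Finset.sum_add_distrib, ← Finset.sum_sub_distrib]
  exact Finset.sum_congr rfl fun t _ => by ring

theorem userUtility_eq_sub (M : TFM K) (H : History) (s : ℕ → ℝ) (v b : ℕ → ℝ≥0)
    (B : Finset ℕ) (τ : ℕ → ℝ) (t : ℕ) :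
    M.userUtility H s v b B τ t = M.userUtility H s v b B 0 t - τ t * s t := by
  simp [userUtility]

theorem outcome_subset (M : TFM K) (H : History) (T : Finset ℕ) (s : ℕ → ℝ) (b : ℕ → ℝ≥0) :
    M.outcome H T s b ⊆ T :=
  M.alloc.block_subset _ _ _ _

theorem sum_outcome_le (M : TFM K) (H : History) {T : Finset ℕ} {s : ℕ → ℝ} (b : ℕ → ℝ≥0)
    (hs : ∀ t ∈ T, 0 < s t) : ∑ t ∈ M.outcome H T s b, s t ≤ K :=
  M.alloc.block_feasible H T s _ hs

/-- A feasible block with a larger joint utility can be turned, by sharing the gain equally, into an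
agreement from which everyone profits. -/
theorem exists_improvedBy_of_jointUtility_lt (M : TFM K) (μ : ℝ) (H : History) {T : Finset ℕ}
    {s : ℕ → ℝ} (v b b' : ℕ → ℝ≥0) {B : Finset ℕ} (hs : ∀ t ∈ T, 0 < s t) (hB : B ⊆ T)
    (hBK : ∑ t ∈ B, s t ≤ K)
    (hlt : M.jointUtility μ H s v b (M.outcome H T s b) < M.jointUtility μ H s v b' B) :
    ∃ A : OCA K T s, M.ImprovedBy μ H T s v b A := by
  set O := M.outcome H T s b
  set δ : ℝ := (M.jointUtility μ H s v b' B - M.jointUtility μ H s v b O) / (T.card + 1)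
  have hcard : (0 : ℝ) < T.card + 1 := by positivity
  have hδ0 : 0 < δ := div_pos (sub_pos.2 hlt) hcard
  have hδmul : δ * (T.card + 1) = M.jointUtility μ H s v b' B - M.jointUtility μ H s v b O :=
    div_mul_cancel₀ _ hcard.ne'
  let τ : ℕ → ℝ := fun t =>
    (M.userUtility H s v b' B 0 t - M.userUtility H s v b O 0 t - δ) / s t
  have hu : ∀ t ∈ T, M.userUtility H s v b' B τ t = M.userUtility H s v b O 0 t + δ := by
    intro t ht
    rw [userUtility_eq_sub, div_mul_cancel₀ _ (hs t ht).ne']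
    ring
  refine ⟨⟨b', B, τ, hB, hBK⟩, fun t ht => ?_, ?_⟩
  · change _ < M.userUtility H s v b' B τ t
    rw [hu t ht]
    exact lt_add_of_pos_right _ hδ0
  · change M.minerUtility μ H T s b O 0 < M.minerUtility μ H T s b' B τ
    have h₁ := M.sum_userUtility_add_minerUtility μ H s v b' hB τ
    have h₂ := M.sum_userUtility_add_minerUtility μ H s v b (M.outcome_subset H T s b) 0
    rw [Finset.sum_congr rfl hu, Finset.sum_add_distrib, Finset.sum_const, nsmul_eq_mul] at h₁
    change _ + M.minerUtility μ H T s b O 0 = M.jointUtility μ H s v b O at h₂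
    change ∑ t ∈ T, M.userUtility H s v b O 0 t + _ = _ at h₂
    linarith

/-- If every transaction fills the whole block, at most one is included. -/
theorem card_outcome_le_one (M : TFM K) (hK : 0 < K) (H : History) (T : Finset ℕ)
    (b : ℕ → ℝ≥0) : (M.outcome H T (fun _ => K) b).card ≤ 1 := by
  have h := M.sum_outcome_le H (T := T) (s := fun _ => K) b fun _ _ => hK
  rw [Finset.sum_const, nsmul_eq_mul] at h
  have : ((M.outcome H T (fun _ => K) b).card : ℝ) ≤ 1 := by
    by_contra! hlt
    nlinarith
  exact_mod_cast this

/-- Of two transactions that each fill the whole block, at least one is left out. -/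
theorem exists_outcome_subset_singleton (M : TFM K) (hK : 0 < K) (H : History) (b : ℕ → ℝ≥0) :
    ∃ i ∈ ({0, 1} : Finset ℕ), ∃ j ∈ ({0, 1} : Finset ℕ), j ≠ i ∧
      M.outcome H {0, 1} (fun _ => K) b ⊆ {i} := by
  have hc := M.card_outcome_le_one hK H {0, 1} b
  have hsub := M.outcome_subset H {0, 1} (fun _ => K) b
  rcases Finset.card_le_one_iff_subset_singleton.1 hc with ⟨k, hk⟩
  by_cases h : k = 1
  · exact ⟨1, by simp, 0, by simp, by simp, h ▸ hk⟩
  · refine ⟨0, by simp, 1, by simp, by simp, fun t ht => ?_⟩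
    have h₁ := hsub ht
    have h₂ := hk ht
    simp only [Finset.mem_insert, Finset.mem_singleton] at h₁ h₂ ⊢
    omega

end TFM

section BurnFPA

variable {β K c μ : ℝ} {hβ0 : 0 ≤ β} {hβ1 : β ≤ 1} {x : AllocationRule K}

theorem jointUtility_burnFPA (H : History) (s : ℕ → ℝ) (v b : ℕ → ℝ≥0) (B : Finset ℕ) :
    (burnFPA β hβ0 hβ1 x).jointUtility μ H s v b B = ∑ t ∈ B, ((v t : ℝ) - β * b t - μ) * s t :=
  Finset.sum_coe_sort B fun t => ((v t : ℝ) - β * b t - μ) * s t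

theorem jointUtility_burnFPA_le_of_subset_singleton (H : History) (v b : ℕ → ℝ≥0)
    {B : Finset ℕ} {i : ℕ} {d : ℝ} (hK : 0 ≤ K) (hB : B ⊆ {i}) (hd : 0 ≤ d)
    (h : (v i : ℝ) - β * b i - μ ≤ d) :
    (burnFPA β hβ0 hβ1 x).jointUtility μ H (fun _ => K) v b B ≤ d * K := by
  rw [jointUtility_burnFPA]
  rcases Finset.subset_singleton_iff.1 hB with rfl | rfl
  · simpa using mul_nonneg hd hK
  · simpa using mul_le_mul_of_nonneg_right h hK

/-- If all transactions fill the whole block, the only one with a positive bid is included as soon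
as its bid exceeds the marginal cost. -/
theorem outcome_burnFPA_eq_singleton (hx : x.Maximizes c μ) (hK : 0 < K) (hμ : 0 ≤ μ)
    (H : History) {T : Finset ℕ} {b : ℕ → ℝ≥0} {i : ℕ} (hi : i ∈ T) (hbi : μ < c * b i)
    (hb : ∀ j ∈ T, j ≠ i → b j = 0) :
    (burnFPA β hβ0 hβ1 x).outcome H T (fun _ => K) b = {i} := by
  have hsub := (burnFPA β hβ0 hβ1 x).outcome_subset H T (fun _ => K) b
  have hmax := hx H T (fun _ => K) b (fun _ _ => hK) {i} (Finset.singleton_subset_iff.2 hi)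
    (by simp)
  change _ ≤ ∑ t ∈ (burnFPA β hβ0 hβ1 x).outcome H T (fun _ => K) b, _ at hmax
  rcases Finset.card_le_one_iff_subset_singleton.1
    ((burnFPA β hβ0 hβ1 x).card_outcome_le_one hK H T b) with ⟨k, hk⟩
  have hpos : 0 < (c * b i - μ) * K := mul_pos (sub_pos.2 hbi) hK
  rcases Finset.subset_singleton_iff.1 hk with h | h
  · rw [h] at hmax
    simp only [Finset.sum_singleton, Finset.sum_empty] at hmax
    exact absurd hmax hpos.not_ge
  · by_cases hki : k = i
    · rw [h, hki]
    · have hbk := hb k (hsub (h ▸ Finset.mem_singleton_self k)) hki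
      rw [h] at hmax
      simp only [Finset.sum_singleton, hbk, NNReal.coe_zero, mul_zero, zero_sub] at hmax
      nlinarith [mul_nonneg hμ hK.le]

/-- A single transaction is left out if its bid is below the marginal cost. -/
theorem outcome_burnFPA_singleton_eq_empty (hx : x.Maximizes c μ) (hK : 0 < K) (H : History)
    {b : ℕ → ℝ≥0} {i : ℕ} (hbi : c * b i < μ) :
    (burnFPA β hβ0 hβ1 x).outcome H {i} (fun _ => K) b = ∅ := by
  have hmax := hx H {i} (fun _ => K) b (fun _ _ => hK) ∅ (Finset.empty_subset _)
    (by simpa using hK.le)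
  change _ ≤ ∑ t ∈ (burnFPA β hβ0 hβ1 x).outcome H {i} (fun _ => K) b, _ at hmax
  refine (Finset.subset_singleton_iff.1
    ((burnFPA β hβ0 hβ1 x).outcome_subset H {i} (fun _ => K) b)).resolve_right fun h => ?_
  rw [h] at hmax
  simp only [Finset.sum_singleton, Finset.sum_empty] at hmax
  nlinarith [mul_pos (sub_pos.2 hbi) hK]

/-- Every bidding strategy is beaten, in joint utility, by some feasible block: positive bids above
the marginal cost are burned, and zero bids do not reveal which transaction is worth more. -/
theorem exists_block_jointUtility_gt (hβ : 0 < β) (hK : 0 < K) (hμ : 0 ≤ μ)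
    (H : History) (σ : ℝ≥0 → ℝ≥0) :
    ∃ (T : Finset ℕ) (s : ℕ → ℝ) (v : ℕ → ℝ≥0) (b : ℕ → ℝ≥0) (B : Finset ℕ),
      (∀ t ∈ T, 0 < s t) ∧ B ⊆ T ∧ ∑ t ∈ B, s t ≤ K ∧
      (burnFPA β hβ0 hβ1 x).jointUtility μ H s v (σ ∘ v)
          ((burnFPA β hβ0 hβ1 x).outcome H T s (σ ∘ v))
        < (burnFPA β hβ0 hβ1 x).jointUtility μ H s v b B := by
  lift μ to ℝ≥0 using hμ
  by_cases h : ∃ w : ℝ≥0, μ < w ∧ 0 < σ w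
  · obtain ⟨w, hw, hσ⟩ := h
    have hw' : (μ : ℝ) < w := hw
    have hσ' : (0 : ℝ) < σ w := hσ
    refine ⟨{0}, fun _ => K, fun _ => w, fun _ => 0, {0}, fun _ _ => hK, subset_rfl, by simp, ?_⟩
    refine (jointUtility_burnFPA_le_of_subset_singleton H _ _ hK.le
      (TFM.outcome_subset _ _ _ _ _) (le_max_right ((w : ℝ) - β * σ w - μ) 0)
      (le_max_left _ _)).trans_lt ?_
    rw [jointUtility_burnFPA, Finset.sum_singleton]
    refine mul_lt_mul_of_pos_right (max_lt ?_ ?_) hK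
    · simpa using mul_pos hβ hσ'
    · simpa using hw'
  · push Not at h
    obtain ⟨i, -, j, hj, hji, hsub⟩ :=
      (burnFPA β hβ0 hβ1 x).exists_outcome_subset_singleton hK H fun _ => 0
    let v : ℕ → ℝ≥0 := fun t => if t = i then μ + 1 else μ + 2
    have hσv : σ ∘ v = fun _ => 0 := by
      funext t
      refine nonpos_iff_eq_zero.1 (h _ ?_)
      dsimp only [v]
      split_ifs <;> exact lt_add_of_pos_right _ (by norm_num)
    refine ⟨{0, 1}, fun _ => K, v, fun _ => 0, {j}, fun _ _ => hK,
      Finset.singleton_subset_iff.2 hj, by simp, ?_⟩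
    rw [hσv]
    refine (jointUtility_burnFPA_le_of_subset_singleton H _ _ hK.le hsub zero_le_one
      (by simp [v])).trans_lt ?_
    rw [jointUtility_burnFPA, Finset.sum_singleton]
    refine mul_lt_mul_of_pos_right ?_ hK
    simp [v, hji]

/-- If the allocation rule depends on the bids, every bidding strategy is beaten, in joint utility,
by the on-chain outcome of other bids. The bid `μ / c` is the least that may be included. -/
theorem exists_bid_jointUtility_gt (hx : x.Maximizes c μ) (hc : 0 < c) (hβ : 0 < β) (hK : 0 < K)
    (hμ : 0 ≤ μ) (H : History) (σ : ℝ≥0 → ℝ≥0) :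
    ∃ (T : Finset ℕ) (s : ℕ → ℝ) (v : ℕ → ℝ≥0) (b : ℕ → ℝ≥0),
      (∀ t ∈ T, 0 < s t) ∧
      (burnFPA β hβ0 hβ1 x).jointUtility μ H s v (σ ∘ v)
          ((burnFPA β hβ0 hβ1 x).outcome H T s (σ ∘ v))
        < (burnFPA β hβ0 hβ1 x).jointUtility μ H s v b
          ((burnFPA β hβ0 hβ1 x).outcome H T s b) := by
  obtain ⟨r, hr⟩ : ∃ r : ℝ≥0, c * r = μ :=
    ⟨⟨μ / c, div_nonneg hμ hc.le⟩, mul_div_cancel₀ μ hc.ne'⟩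
  obtain ⟨p, hp⟩ : ∃ p : ℝ≥0, (p : ℝ) = β * r + μ :=
    ⟨⟨β * r + μ, add_nonneg (mul_nonneg hβ.le r.2) hμ⟩, rfl⟩
  have above : ∀ {q : ℝ≥0}, r < q → μ < c * q := fun {q} hq =>
    hr ▸ mul_lt_mul_of_pos_left (NNReal.coe_lt_coe.2 hq) hc
  by_cases h : ∃ w : ℝ≥0, p < w ∧ σ w ≠ r
  · obtain ⟨w, hw, hσ⟩ := h
    have hw' : β * r + μ < w := hp ▸ NNReal.coe_lt_coe.2 hw
    rcases lt_or_gt_of_ne hσ with hlt | hgt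
    · obtain ⟨q, hrq, hq⟩ : ∃ q : ℝ≥0, r < q ∧ (q : ℝ) < (w - μ) / β := by
        have : (r : ℝ) < (w - μ) / β := by rw [lt_div_iff₀ hβ]; linarith
        obtain ⟨q, h₁, h₂⟩ := exists_between this
        exact ⟨⟨q, r.2.trans h₁.le⟩, h₁, h₂⟩
      refine ⟨{0}, fun _ => K, fun _ => w, fun _ => q, fun _ _ => hK, ?_⟩
      rw [outcome_burnFPA_singleton_eq_empty hx hK H
          (by simpa [← hr] using mul_lt_mul_of_pos_left (NNReal.coe_lt_coe.2 hlt) hc),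
        outcome_burnFPA_eq_singleton hx hK hμ H (Finset.mem_singleton_self 0) (above hrq)
          (by simp), jointUtility_burnFPA, jointUtility_burnFPA, Finset.sum_empty,
        Finset.sum_singleton]
      rw [lt_div_iff₀ hβ] at hq
      exact mul_pos (by linarith) hK
    · obtain ⟨q, hrq, hq⟩ := exists_between hgt
      refine ⟨{0}, fun _ => K, fun _ => w, fun _ => q, fun _ _ => hK, ?_⟩
      rw [outcome_burnFPA_eq_singleton hx hK hμ H (Finset.mem_singleton_self 0) (above hgt)
          (by simp), outcome_burnFPA_eq_singleton hx hK hμ H (Finset.mem_singleton_self 0)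
          (above hrq) (by simp), jointUtility_burnFPA, jointUtility_burnFPA,
        Finset.sum_singleton, Finset.sum_singleton]
      have := mul_lt_mul_of_pos_left (NNReal.coe_lt_coe.2 hq) hβ
      exact mul_lt_mul_of_pos_right (by simpa using this) hK
  · push Not at h
    obtain ⟨i, -, j, hj, hji, hsub⟩ :=
      (burnFPA β hβ0 hβ1 x).exists_outcome_subset_singleton hK H fun _ => r
    let v : ℕ → ℝ≥0 := fun t => if t = i then p + 1 else p + 2
    have hσv : σ ∘ v = fun _ => r := by
      funext t
      refine h _ ?_
      dsimp only [v]
      split_ifs <;> exact lt_add_of_pos_right _ (by norm_num)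
    refine ⟨{0, 1}, fun _ => K, v, fun t => if t = j then r + 1 / 2 else 0, fun _ _ => hK, ?_⟩
    rw [hσv, outcome_burnFPA_eq_singleton hx hK hμ H hj
      (above (by simp)) (fun k _ hk => if_neg hk)]
    refine (jointUtility_burnFPA_le_of_subset_singleton H _ _ hK.le hsub zero_le_one
      (by simp only [v, if_true, NNReal.coe_add, NNReal.coe_one]; linarith)).trans_lt ?_
    rw [jointUtility_burnFPA, Finset.sum_singleton]
    refine mul_lt_mul_of_pos_right ?_ hK
    simp only [v, if_neg hji, if_true, NNReal.coe_add, NNReal.coe_div, NNReal.coe_one,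
      NNReal.coe_ofNat]
    linarith

end BurnFPA

/-- For every `β ∈ (0,1]`, the `β`-burn first-price auction is not OCA-proof. The allocation rule
is either the one of first-price auctions or the revenue-maximizing one (they agree for `μ = 0`
and `β < 1`). Moreover, for every bidding strategy, individually rational or not, the joint
utility of its outcome is beaten by an outcome that an off-chain agreement can reach; and by the
on-chain outcome of other bids, unless `β = 1` and the allocation rule merely maximizes a revenue
that does not depend on the bids. -/
theorem beta_burn_fpa_not_oca_proof
    (β K μ : ℝ) (hβ0 : 0 < β) (hβ1 : β ≤ 1) (hK : 0 < K) (hμ : 0 ≤ μ)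
    (x : AllocationRule K) (hx : x.IsFirstPrice μ ∨ x.IsRevenueMaximizing β μ)
    (M : TFM K) (hM : M = burnFPA β hβ0.le hβ1 x) :
    ¬ M.OCAProof μ ∧
    (∀ (H : History) (σ : ℝ≥0 → ℝ≥0),
      ∃ (T : Finset ℕ) (s : ℕ → ℝ) (v : ℕ → ℝ≥0) (b : ℕ → ℝ≥0) (B : Finset ℕ),
        (∀ t ∈ T, 0 < s t) ∧ B ⊆ T ∧ ∑ t ∈ B, s t ≤ K ∧
        M.jointUtility μ H s v (σ ∘ v) (M.outcome H T s (σ ∘ v))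
          < M.jointUtility μ H s v b B) ∧
    (x.IsFirstPrice μ ∨ β < 1 →
      ∀ (H : History) (σ : ℝ≥0 → ℝ≥0),
        ∃ (T : Finset ℕ) (s : ℕ → ℝ) (v : ℕ → ℝ≥0) (b : ℕ → ℝ≥0),
          (∀ t ∈ T, 0 < s t) ∧
          M.jointUtility μ H s v (σ ∘ v) (M.outcome H T s (σ ∘ v))
            < M.jointUtility μ H s v b (M.outcome H T s b)) := by
  subst hM
  have hblock := fun H σ => exists_block_jointUtility_gt (hβ0 := hβ0.le) (hβ1 := hβ1) (x := x)
    hβ0 hK hμ H σ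
  refine ⟨fun hproof => ?_, hblock, fun hc H σ => ?_⟩
  · obtain ⟨σ, -, hσ⟩ := hproof []
    obtain ⟨T, s, v, b, B, hs, hB, hBK, hlt⟩ := hblock [] σ
    exact hσ T s v hs (TFM.exists_improvedBy_of_jointUtility_lt _ μ [] v _ b hs hB hBK hlt)
  · obtain ⟨c, hc0, hmax⟩ : ∃ c, 0 < c ∧ x.Maximizes c μ := by
      rcases hc with hfp | hlt
      · exact ⟨1, one_pos, hfp⟩
      · rcases hx with hfp | hrev
        · exact ⟨1, one_pos, hfp⟩
        · exact ⟨1 - β, sub_pos.2 hlt, hrev⟩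
    exact exists_bid_jointUtility_gt hmax hc0 hβ0 hK hμ H σ
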